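/- arXiv:1405.5317 — 3 statements merged into one kernel-verified Lean document; each statement's English description precedes it below -/
import Mathlib

section
/- Let A₁, A₂ be bounded operators on H satisfying ‖[A₁, A₂(a)]‖ ≤ c·D_κ(a) for all a ∈ ℝ⁴. Let χ₁, χ₂ : ℝ⁴ → ℂ be smooth functions such that for every multi-index α there exist C_α and r_α ≥ 4 + κ with |D^α χ_i(x)| ≤ C_α·(λ + |x|)^{−r_α} for all x (i = 1,2). Set B_i = A_i(χ_i). Then: (a) the maps x ↦ B_i(x) from ℝ⁴ to the bounded operators are infinitely differentiable in operator norm, with ∂^α_x B_i(x)|_{x=0} = A_i((−1)^{|α|} D^α χ_i) for every multi-index α; (b) for all multi-indices α, β there exists a constant c_{αβ} such that ‖[∂^α_x B₁(x)|_{x=0}, (∂^β_x B₂(x)|_{x=0})(a)]‖ ≤ c_{αβ}·D_κ(a) for all a ∈ ℝ⁴. -/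
noncomputable section

open ContinuousLinearMap MeasureTheory

/-- Minkowski space modeled as `ℝ⁴` with the Euclidean structure. -/
abbrev M4 : Type := EuclideanSpace ℝ (Fin 4)

/-- Euclidean norm of the spatial part `a⃗` of `a ∈ ℝ⁴`. -/
def snorm3 (a : M4) : ℝ := Real.sqrt ((a 1) ^ 2 + (a 2) ^ 2 + (a 3) ^ 2)

/-- The commutator-bounding function `D_κ` (with length parameter `lam`). -/
def Dkappa (lam κ : ℝ) (a : M4) : ℝ :=
  if (snorm3 a) ^ 2 ≤ (a 0) ^ 2 then 1
  else lam ^ κ / (lam + snorm3 a - |a 0|) ^ κ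

/-- Iterated partial derivative `D^α` along the coordinate directions listed in `α`. -/
def pderivs {F : Type*} [NormedAddCommGroup F] [NormedSpace ℝ F] :
    List (Fin 4) → (M4 → F) → M4 → F
  | [], f => f
  | i :: rest, f => pderivs rest fun x => fderiv ℝ f x (EuclideanSpace.single i 1)

/-- Polynomial weight. -/
def wt (s κ : ℝ) (x : M4) : ℝ := (s + ‖x‖) ^ (-(4 + κ))

lemma wt_pos {s κ : ℝ} (hs : 0 < s) (x : M4) : 0 < wt s κ x :=
  Real.rpow_pos_of_pos (by positivity) _

lemma wt_eq {s κ : ℝ} (hs : 0 < s) (x : M4) :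
    wt s κ x = s ^ (-(4 + κ)) * wt 1 κ (s⁻¹ • x) := by
  unfold wt
  rw [← Real.mul_rpow hs.le (by positivity), norm_smul, norm_inv, Real.norm_of_nonneg hs.le]
  congr 1
  field_simp

lemma wt_one_int {κ : ℝ} (hκ : 0 < κ) : Integrable (wt 1 κ) := by
  apply integrable_one_add_norm
  simp [hκ]

lemma wt_int {s κ : ℝ} (hs : 0 < s) (hκ : 0 < κ) : Integrable (wt s κ) := by
  have : wt s κ = fun x => s ^ (-(4 + κ)) * wt 1 κ (s⁻¹ • x) := funext (wt_eq hs)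
  rw [this]
  exact ((integrable_comp_smul_iff volume _ (inv_ne_zero hs.ne')).2 (wt_one_int hκ)).const_mul _

lemma wt_integral {s κ : ℝ} (hs : 0 < s) :
    ∫ x, wt s κ x = s ^ (-κ) * ∫ x, wt 1 κ x := by
  simp_rw [wt_eq hs]
  rw [integral_const_mul, Measure.integral_comp_inv_smul]
  simp only [finrank_euclideanSpace, Fintype.card_fin, smul_eq_mul]
  rw [abs_of_pos (by positivity), ← mul_assoc, ← Real.rpow_natCast s 4, ← Real.rpow_add hs]
  congr 2
  push_cast; ring

lemma wt_compare {s t κ k : ℝ} (hκ : 0 < κ) (hk : 0 < k) (hs : 0 < s) (x y : M4)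
    (h : s + ‖y‖ ≤ k * (t + ‖x‖)) :
    wt t κ x ≤ k ^ (4 + κ) * wt s κ y := by
  unfold wt
  have h1 : 0 < s + ‖y‖ := by positivity
  have h2 : 0 < t + ‖x‖ := pos_of_mul_pos_right (h1.trans_le h) hk.le
  calc (t + ‖x‖) ^ (-(4 + κ)) = k ^ (4 + κ) * (k * (t + ‖x‖)) ^ (-(4 + κ)) := by
        rw [Real.mul_rpow hk.le h2.le, ← mul_assoc, ← Real.rpow_add hk]; simp
    _ ≤ _ := by
        refine mul_le_mul_of_nonneg_left ?_ (by positivity)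
        exact Real.rpow_le_rpow_of_nonpos h1 h (by linarith)

/-- spacelike distance -/
def sd (a : M4) : ℝ := max 0 (snorm3 a - |a 0|)

lemma sd_nonneg (a : M4) : 0 ≤ sd a := le_max_left _ _

lemma snorm3_nonneg (a : M4) : 0 ≤ snorm3 a := Real.sqrt_nonneg _

lemma Dkappa_eq {lam κ : ℝ} (hlam : 0 < lam) (a : M4) :
    Dkappa lam κ a = lam ^ κ * (lam + sd a) ^ (-κ) := by
  unfold Dkappa sd
  have h3 := snorm3_nonneg a
  split_ifs with h
  · have : snorm3 a ≤ |a 0| := by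
      rw [← sq_abs (a 0)] at h
      exact le_of_sq_le_sq h (abs_nonneg _)
    rw [max_eq_left (by linarith), add_zero, ← Real.rpow_add hlam]; simp
  · have : |a 0| < snorm3 a := by
      rw [← sq_abs (a 0)] at h
      exact lt_of_pow_lt_pow_left₀ 2 h3 (not_le.1 h)
    rw [max_eq_right (by linarith), Real.rpow_neg (by linarith), div_eq_mul_inv, add_sub_assoc]

lemma snorm3_eq (a : M4) : snorm3 a = ‖(!₂[a 1, a 2, a 3] : EuclideanSpace ℝ (Fin 3))‖ := by
  simp [snorm3, EuclideanSpace.norm_eq, Fin.sum_univ_three]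

lemma snorm3_le (a : M4) : snorm3 a ≤ ‖a‖ := by
  rw [snorm3, EuclideanSpace.norm_eq]
  apply Real.sqrt_le_sqrt
  simp [Fin.sum_univ_four]
  nlinarith [sq_nonneg (a 0)]

lemma snorm3_add (a b : M4) : snorm3 (a + b) ≤ snorm3 a + snorm3 b := by
  simp only [snorm3_eq]
  refine le_trans (le_of_eq ?_) (norm_add_le _ _)
  congr 1
  ext i
  fin_cases i <;> simp

lemma sd_add (a z : M4) : sd a ≤ sd (a + z) + 2 * ‖z‖ := by
  have h1 := snorm3_add (a + z) (-z)
  have h2 := snorm3_le (-z)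
  have h3 : |a 0 + z 0| ≤ |a 0| + |z 0| := abs_add_le _ _
  have h4 : |z 0| ≤ ‖z‖ := PiLp.norm_apply_le z 0
  have h5 : snorm3 (a + z) - |a 0 + z 0| ≤ sd (a + z) := le_max_right _ _
  rw [norm_neg] at h2
  rw [add_neg_cancel_right] at h1
  have := norm_nonneg z
  have := sd_nonneg (a + z)
  apply max_le <;> linarith

lemma Dkappa_le_one {lam κ : ℝ} (hlam : 0 < lam) (hκ : 0 < κ) (a : M4) : Dkappa lam κ a ≤ 1 := by
  rw [Dkappa_eq hlam]
  have h := sd_nonneg a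
  calc lam ^ κ * (lam + sd a) ^ (-κ) ≤ lam ^ κ * lam ^ (-κ) := by
        gcongr ?_ * ?_
        exact Real.rpow_le_rpow_of_nonpos hlam (by linarith) (by linarith)
    _ = 1 := by rw [← Real.rpow_add hlam]; simp

lemma Dkappa_pos {lam κ : ℝ} (hlam : 0 < lam) (a : M4) : 0 < Dkappa lam κ a := by
  rw [Dkappa_eq hlam]
  have h := sd_nonneg a
  positivity

lemma key_pointwise {lam κ : ℝ} (hlam : 0 < lam) (hκ : 0 < κ) :
    ∃ K : ℝ, 0 ≤ K ∧ ∀ a x y : M4, wt lam κ x * wt lam κ y * Dkappa lam κ (y + a - x) ≤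
      K * (Dkappa lam κ a * wt lam κ x * wt lam κ y + wt lam κ x * wt (lam + sd a) κ y
        + wt (lam + sd a) κ x * wt lam κ y) := by
  refine ⟨2 ^ κ + 9 ^ (4 + κ), by positivity, fun a x y => ?_⟩
  have hd := sd_nonneg a
  have hs : 0 < lam + sd a := by linarith
  have p1 := wt_pos (κ := κ) hlam x
  have p2 := wt_pos (κ := κ) hlam y
  have p3 := wt_pos (κ := κ) hs x
  have p4 := wt_pos (κ := κ) hs y
  have p5 := Dkappa_pos (κ := κ) hlam a
  have p6 := Dkappa_pos (κ := κ) hlam (y + a - x)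
  have p7 := Dkappa_le_one hlam hκ (y + a - x)
  have q1 : (0:ℝ) < 2 ^ κ := by positivity
  have q2 : (0:ℝ) < 9 ^ (4 + κ) := by positivity
  by_cases hx : sd a / 8 < ‖x‖
  · have h1 : wt lam κ x ≤ 9 ^ (4 + κ) * wt (lam + sd a) κ x :=
      wt_compare hκ (by norm_num) hs x x (by linarith)
    calc wt lam κ x * wt lam κ y * Dkappa lam κ (y + a - x)
        ≤ (9 ^ (4 + κ) * wt (lam + sd a) κ x) * wt lam κ y * 1 := by gcongr
      _ = 9 ^ (4 + κ) * (0 + 0 + wt (lam + sd a) κ x * wt lam κ y) := by ring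
      _ ≤ _ := by gcongr <;> first | positivity | linarith
  by_cases hy : sd a / 8 < ‖y‖
  · have h1 : wt lam κ y ≤ 9 ^ (4 + κ) * wt (lam + sd a) κ y :=
      wt_compare hκ (by norm_num) hs y y (by linarith)
    calc wt lam κ x * wt lam κ y * Dkappa lam κ (y + a - x)
        ≤ wt lam κ x * (9 ^ (4 + κ) * wt (lam + sd a) κ y) * 1 := by gcongr
      _ = 9 ^ (4 + κ) * (0 + wt lam κ x * wt (lam + sd a) κ y + 0) := by ring
      _ ≤ _ := by gcongr <;> first | positivity | linarith
  · have h0 := sd_add a (y - x)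
    have h2 := norm_sub_le y x
    have e : a + (y - x) = y + a - x := by abel
    rw [e] at h0
    have h3 : Dkappa lam κ (y + a - x) ≤ 2 ^ κ * Dkappa lam κ a := by
      rw [Dkappa_eq hlam, Dkappa_eq hlam]
      calc lam ^ κ * (lam + sd (y + a - x)) ^ (-κ) ≤ lam ^ κ * ((lam + sd a) / 2) ^ (-κ) := by
            gcongr ?_ * ?_
            exact Real.rpow_le_rpow_of_nonpos (by linarith) (by linarith) (by linarith)
        _ = _ := by
            rw [Real.div_rpow hs.le (by norm_num), Real.rpow_neg (by norm_num : (0:ℝ) ≤ 2)]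
            field_simp
    calc wt lam κ x * wt lam κ y * Dkappa lam κ (y + a - x)
        ≤ wt lam κ x * wt lam κ y * (2 ^ κ * Dkappa lam κ a) := by gcongr
      _ = 2 ^ κ * (Dkappa lam κ a * wt lam κ x * wt lam κ y + 0 + 0) := by ring
      _ ≤ _ := by gcongr <;> first | positivity | linarith

lemma int3 {u v w : M4 → ℝ} {p q r : ℝ} (hu : Integrable u) (hv : Integrable v)
    (hw : Integrable w) : ∫ x, (p * u x + q * v x + r * w x) =
      p * (∫ x, u x) + q * (∫ x, v x) + r * ∫ x, w x := by
  have h1 : Integrable fun x => p * u x + q * v x := (hu.const_mul p).add (hv.const_mul q)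
  rw [integral_add h1 (hw.const_mul r), integral_add (hu.const_mul p) (hv.const_mul q),
    integral_const_mul, integral_const_mul, integral_const_mul]

section rep
set_option linter.unusedSectionVars false
variable {H : Type*} [NormedAddCommGroup H] [InnerProductSpace ℂ H] [CompleteSpace H]

/-- The hypotheses on the unitary representation. -/
structure URep (U : M4 → H →L[ℂ] H) : Prop where
  zero : U 0 = 1
  add : ∀ x y, U (x + y) = U x * U y
  adj : ∀ x, adjoint (U x) = U (-x)
  cont : ∀ ψ : H, Continuous fun x => U x ψ

/-- Translate of an operator. -/
def tr (U : M4 → H →L[ℂ] H) (T : H →L[ℂ] H) (x : M4) : H →L[ℂ] H := U x * T * U (-x)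

/-- `T` is the smearing of `A` with `f`. -/
def SmearRep (U : M4 → H →L[ℂ] H) (A : H →L[ℂ] H) (f : M4 → ℂ) (T : H →L[ℂ] H) : Prop :=
  ∀ ψ, T ψ = ∫ x : M4, f x • (tr U A x ψ)

variable {U : M4 → H →L[ℂ] H}

lemma URep.inv (hU : URep U) (x : M4) : U (-x) * U x = 1 := by
  rw [← hU.add, neg_add_cancel, hU.zero]

lemma URep.norm_apply (hU : URep U) (x : M4) (v : H) : ‖U x v‖ = ‖v‖ := by
  have h : inner ℂ (U x v) (U x v) = inner ℂ v v := by
    rw [← ContinuousLinearMap.adjoint_inner_left, hU.adj]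
    have := congrArg (fun T : H →L[ℂ] H => T v) (hU.inv x)
    simp only [mul_apply_eq_comp, one_apply_eq_self] at this
    rw [this]
  rw [inner_self_eq_norm_sq_to_K, inner_self_eq_norm_sq_to_K] at h
  have h' : ‖U x v‖ ^ 2 = ‖v‖ ^ 2 := by exact_mod_cast h
  exact (sq_eq_sq₀ (norm_nonneg _) (norm_nonneg _)).1 h'

lemma URep.norm_tr_apply (hU : URep U) (T : H →L[ℂ] H) (x : M4) (v : H) :
    ‖tr U T x v‖ ≤ ‖T‖ * ‖v‖ := by
  simp only [tr, mul_apply_eq_comp]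
  rw [hU.norm_apply]
  refine (T.le_opNorm _).trans ?_
  rw [hU.norm_apply]

lemma URep.norm_tr (hU : URep U) (T : H →L[ℂ] H) (x : M4) : ‖tr U T x‖ ≤ ‖T‖ :=
  ContinuousLinearMap.opNorm_le_bound _ (norm_nonneg _) (hU.norm_tr_apply T x)

lemma URep.tr_add (hU : URep U) (T : H →L[ℂ] H) (x y : M4) :
    tr U T (x + y) = tr U (tr U T y) x := by
  simp only [tr]
  rw [neg_add_rev, hU.add, hU.add]
  simp only [mul_assoc]

lemma URep.tr_zero (hU : URep U) (T : H →L[ℂ] H) : tr U T 0 = T := by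
  simp [tr, hU.zero]

lemma URep.tr_mul (hU : URep U) (S T : H →L[ℂ] H) (x : M4) :
    tr U (S * T) x = tr U S x * tr U T x := by
  simp only [tr]
  calc U x * (S * T) * U (-x) = U x * S * 1 * T * U (-x) := by simp only [mul_assoc, mul_one]
    _ = _ := by rw [← hU.inv x]; simp only [mul_assoc]

lemma tr_sub (S T : H →L[ℂ] H) (x : M4) : tr U (S - T) x = tr U S x - tr U T x := by
  simp only [tr, mul_sub, sub_mul]

lemma URep.cont_comp (hU : URep U) {v : M4 → H} (hv : Continuous v) {g : M4 → M4}
    (hg : Continuous g) : Continuous fun x => U (g x) (v x) := by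
  rw [continuous_iff_continuousAt]
  intro x0
  rw [ContinuousAt, tendsto_iff_norm_sub_tendsto_zero]
  have h1 : Filter.Tendsto (fun x => ‖v x - v x0‖ + ‖U (g x) (v x0) - U (g x0) (v x0)‖)
      (nhds x0) (nhds 0) := by
    have a := tendsto_iff_norm_sub_tendsto_zero.1 (hv.continuousAt (x := x0)).tendsto
    have b := tendsto_iff_norm_sub_tendsto_zero.1
      (((hU.cont (v x0)).comp hg).continuousAt (x := x0)).tendsto
    simpa using a.add b
  refine squeeze_zero (fun _ => norm_nonneg _) (fun x => ?_) h1
  have : U (g x) (v x) - U (g x0) (v x0)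
      = U (g x) (v x - v x0) + (U (g x) (v x0) - U (g x0) (v x0)) := by
    rw [map_sub]; abel
  rw [this]
  refine (norm_add_le _ _).trans ?_
  rw [hU.norm_apply]

lemma URep.cont_tr (hU : URep U) (T : H →L[ℂ] H) (ψ : H) : Continuous fun x => tr U T x ψ := by
  simp only [tr, mul_apply_eq_comp]
  exact hU.cont_comp (T.continuous.comp (hU.cont_comp continuous_const continuous_neg))
    continuous_id

lemma URep.int (hU : URep U) (A : H →L[ℂ] H) {f : M4 → ℂ} (hf : Integrable f) (ψ : H) :
    Integrable fun x => f x • tr U A x ψ := by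
  refine (hf.norm.mul_const (‖A‖ * ‖ψ‖)).mono'
    (hf.aestronglyMeasurable.smul (hU.cont_tr A ψ).aestronglyMeasurable) ?_
  refine Filter.Eventually.of_forall fun x => ?_
  rw [norm_smul]
  gcongr
  exact hU.norm_tr_apply A x ψ

lemma URep.exists_rep (hU : URep U) (A : H →L[ℂ] H) {f : M4 → ℂ} (hf : Integrable f) :
    ∃ T, SmearRep U A f T := by
  refine ⟨LinearMap.mkContinuous
    { toFun := fun ψ => ∫ x : M4, f x • tr U A x ψ
      map_add' := fun u v => ?_
      map_smul' := fun r u => ?_ } ((∫ x, ‖f x‖) * ‖A‖) ?_, fun ψ => rfl⟩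
  · rw [← integral_add (hU.int A hf u) (hU.int A hf v)]
    simp [smul_add]
  · rw [RingHom.id_apply, ← integral_smul]
    congr 1
    ext x
    rw [map_smul, smul_comm]
  · intro ψ
    simp only [LinearMap.coe_mk, AddHom.coe_mk]
    rw [mul_assoc, ← integral_mul_const]
    refine norm_integral_le_of_norm_le (hf.norm.mul_const _) (Filter.Eventually.of_forall fun x => ?_)
    rw [norm_smul]
    gcongr
    exact hU.norm_tr_apply A x ψ

lemma URep.norm_rep_le (hU : URep U) {A T : H →L[ℂ] H} {f : M4 → ℂ} {g : M4 → ℝ}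
    (hT : SmearRep U A f T) (hg : Integrable g) (h : ∀ x, ‖f x‖ ≤ g x) :
    ‖T‖ ≤ (∫ x, g x) * ‖A‖ := by
  refine ContinuousLinearMap.opNorm_le_bound _ ?_ fun ψ => ?_
  · exact mul_nonneg (integral_nonneg fun x => (norm_nonneg _).trans (h x)) (norm_nonneg _)
  · rw [hT ψ, mul_assoc, ← integral_mul_const]
    refine norm_integral_le_of_norm_le (hg.mul_const _) (Filter.Eventually.of_forall fun x => ?_)
    rw [norm_smul]
    exact mul_le_mul (h x) (hU.norm_tr_apply A x ψ) (norm_nonneg _) ((norm_nonneg _).trans (h x))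

lemma URep.tr_rep_apply (hU : URep U) {A T : H →L[ℂ] H} {f : M4 → ℂ} (hf : Integrable f)
    (hT : SmearRep U A f T) (a : M4) (ψ : H) :
    tr U T a ψ = ∫ x, f x • tr U A (x + a) ψ := by
  have : tr U T a ψ = U a (T (U (-a) ψ)) := rfl
  rw [this, hT, ← ContinuousLinearMap.integral_comp_comm _ (hU.int A hf _)]
  congr 1
  ext x
  rw [map_smul, add_comm, hU.tr_add]
  rfl

lemma URep.rep_tr (hU : URep U) {A T : H →L[ℂ] H} {f : M4 → ℂ} (hf : Integrable f)
    (hT : SmearRep U A f T) (a : M4) : SmearRep U A (fun x => f (x - a)) (tr U T a) := by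
  intro ψ
  rw [hU.tr_rep_apply hf hT, ← integral_sub_right_eq_self _ a]
  simp

lemma URep.rep_add (hU : URep U) {A S T : H →L[ℂ] H} {f g : M4 → ℂ} (hf : Integrable f)
    (hg : Integrable g) (hS : SmearRep U A f S) (hT : SmearRep U A g T) :
    SmearRep U A (fun x => f x + g x) (S + T) := by
  intro ψ
  simp only [add_smul]
  rw [integral_add (hU.int A hf ψ) (hU.int A hg ψ), ← hS ψ, ← hT ψ]
  rfl

lemma rep_smul {A T : H →L[ℂ] H} {f : M4 → ℂ}
    (hT : SmearRep U A f T) (r : ℂ) : SmearRep U A (fun x => r * f x) (r • T) := by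
  intro ψ
  simp only [mul_smul]
  rw [integral_smul, ← hT ψ]
  rfl

lemma rep_neg {A T : H →L[ℂ] H} {f : M4 → ℂ}
    (hT : SmearRep U A f T) : SmearRep U A (fun x => - f x) (-T) := by
  simpa using rep_smul hT (-1)

lemma URep.rep_sum (hU : URep U) {A : H →L[ℂ] H} {ι : Type*} (s : Finset ι)
    {f : ι → M4 → ℂ} {T : ι → H →L[ℂ] H} (hf : ∀ i, Integrable (f i))
    (hT : ∀ i, SmearRep U A (f i) (T i)) :
    SmearRep U A (fun x => ∑ i ∈ s, f i x) (∑ i ∈ s, T i) := by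
  classical
  induction s using Finset.induction_on with
  | empty => intro ψ; simp
  | insert i s hi ih =>
    simp only [Finset.sum_insert hi]
    exact hU.rep_add (hf i) (integrable_finsetSum _ fun j _ => hf j) (hT i) ih

/-- Commutator estimate for smeared operators. -/
lemma URep.comm_bound (hU : URep U) {lam κ c : ℝ} (hlam : 0 < lam) (hκ : 0 < κ)
    {A0 A1 T0 T1 : H →L[ℂ] H} (hc : ∀ a, ‖A0 * tr U A1 a - tr U A1 a * A0‖ ≤ c * Dkappa lam κ a)
    {f0 f1 : M4 → ℂ} (h0 : Integrable f0) (h1 : Integrable f1) {C0 C1 : ℝ}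
    (b0 : ∀ x, ‖f0 x‖ ≤ C0 * wt lam κ x) (b1 : ∀ x, ‖f1 x‖ ≤ C1 * wt lam κ x)
    (r0 : SmearRep U A0 f0 T0) (r1 : SmearRep U A1 f1 T1) :
    ∃ K : ℝ, ∀ a, ‖T0 * tr U T1 a - tr U T1 a * T0‖ ≤ K * Dkappa lam κ a := by
  obtain ⟨K, hK, hKb⟩ := key_pointwise hlam hκ
  have hC0 : 0 ≤ C0 := by
    by_contra hneg
    have := (norm_nonneg _).trans (b0 0)
    nlinarith [wt_pos (κ := κ) hlam (0 : M4)]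
  have hC1 : 0 ≤ C1 := by
    by_contra hneg
    have := (norm_nonneg _).trans (b1 0)
    nlinarith [wt_pos (κ := κ) hlam (0 : M4)]
  have hc0 : 0 ≤ c := by
    by_contra hneg
    have := (norm_nonneg _).trans (hc 0)
    nlinarith [Dkappa_pos (κ := κ) hlam (0 : M4)]
  set W := ∫ x, wt lam κ x with hW
  set W1 := ∫ x, wt 1 κ x with hW1
  have hWn : 0 ≤ W := integral_nonneg fun x => (wt_pos hlam x).le
  have hW1n : 0 ≤ W1 := integral_nonneg fun x => (wt_pos one_pos x).le
  have iw := wt_int hlam hκ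
  refine ⟨C0 * C1 * c * K * (W * W + 2 * (W * (lam ^ (-κ) * W1))), fun a => ?_⟩
  set D := Dkappa lam κ a with hD
  have hDp : 0 < D := Dkappa_pos hlam a
  have hs : 0 < lam + sd a := by linarith [sd_nonneg a]
  have iws := wt_int hs hκ
  have hWs : ∫ x, wt (lam + sd a) κ x = D * (lam ^ (-κ) * W1) := by
    rw [wt_integral hs, hD, Dkappa_eq hlam, Real.rpow_neg hlam.le]
    have : lam ^ κ ≠ 0 := by positivity
    rw [← hW1]
    field_simp
  have hcxy : ∀ x y ψ, ‖tr U A0 x (tr U A1 (y + a) ψ) - tr U A1 (y + a) (tr U A0 x ψ)‖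
      ≤ c * Dkappa lam κ (y + a - x) * ‖ψ‖ := by
    intro x y ψ
    have e : tr U A0 x (tr U A1 (y + a) ψ) - tr U A1 (y + a) (tr U A0 x ψ) =
      tr U (A0 * tr U A1 (y + a - x) - tr U A1 (y + a - x) * A0) x ψ := by
      rw [tr_sub, hU.tr_mul, hU.tr_mul, ← hU.tr_add, add_sub_cancel]
      rfl
    rw [e]
    refine (hU.norm_tr_apply _ x ψ).trans ?_
    gcongr
    exact hc _
  have inner1 : ∀ x ψ, ‖f0 x‖ * ‖tr U A0 x (tr U T1 a ψ) - tr U T1 a (tr U A0 x ψ)‖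
      ≤ C0 * C1 * c * ‖ψ‖ * K * ((D * W) * wt lam κ x + (D * (lam ^ (-κ) * W1)) * wt lam κ x
        + W * wt (lam + sd a) κ x) := by
    intro x ψ
    have i1 : ∀ φ, Integrable fun y => f1 y • tr U A1 (y + a) φ := by
      intro φ
      have := (hU.int A1 (h1.comp_sub_right a) φ).comp_add_right a
      simpa using this
    have e : tr U A0 x (tr U T1 a ψ) - tr U T1 a (tr U A0 x ψ) =
        ∫ y, f1 y • (tr U A0 x (tr U A1 (y + a) ψ) - tr U A1 (y + a) (tr U A0 x ψ)) := by
      rw [hU.tr_rep_apply h1 r1 a ψ, hU.tr_rep_apply h1 r1 a (tr U A0 x ψ),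
        ← ContinuousLinearMap.integral_comp_comm _ (i1 ψ), ← integral_sub _ (i1 _)]
      · simp only [map_smul, smul_sub]
      · exact (tr U A0 x).integrable_comp (i1 ψ)
    have e2 : ‖f0 x‖ * ‖tr U A0 x (tr U T1 a ψ) - tr U T1 a (tr U A0 x ψ)‖ =
        ‖∫ y, f0 x • (f1 y • (tr U A0 x (tr U A1 (y + a) ψ) - tr U A1 (y + a) (tr U A0 x ψ)))‖ := by
      rw [integral_smul, norm_smul, e]
    rw [e2]
    have ib : Integrable fun y => C0 * C1 * c * ‖ψ‖ * K * (D * wt lam κ x * wt lam κ y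
        + wt lam κ x * wt (lam + sd a) κ y + wt (lam + sd a) κ x * wt lam κ y) :=
      (((iw.const_mul _).add (iws.const_mul _)).add (iw.const_mul _)).const_mul _
    refine (norm_integral_le_of_norm_le ib (Filter.Eventually.of_forall fun y => ?_)).trans
      (le_of_eq ?_)
    · rw [norm_smul, norm_smul]
      have p1 := wt_pos (κ := κ) hlam x
      have p2 := wt_pos (κ := κ) hlam y
      calc _ ≤ (C0 * wt lam κ x) * ((C1 * wt lam κ y) * (c * Dkappa lam κ (y + a - x) * ‖ψ‖)) := by
            have := Dkappa_pos (κ := κ) hlam (y + a - x)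
            gcongr
            · exact b0 x
            · exact b1 y
            · exact hcxy x y ψ
        _ = (C0 * C1 * c * ‖ψ‖) * (wt lam κ x * wt lam κ y * Dkappa lam κ (y + a - x)) := by ring
        _ ≤ C0 * C1 * c * ‖ψ‖ * (K * (D * wt lam κ x * wt lam κ y
        + wt lam κ x * wt (lam + sd a) κ y + wt (lam + sd a) κ x * wt lam κ y)) := by
            exact mul_le_mul_of_nonneg_left (hKb a x y) (by positivity)
        _ = _ := by ring
    · rw [integral_const_mul, int3 iw iws iw, hWs]
      ring
  refine ContinuousLinearMap.opNorm_le_bound _ (by positivity) fun ψ => ?_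
  have e : (T0 * tr U T1 a - tr U T1 a * T0) ψ =
      ∫ x, f0 x • (tr U A0 x (tr U T1 a ψ) - tr U T1 a (tr U A0 x ψ)) := by
    have : (T0 * tr U T1 a - tr U T1 a * T0) ψ = T0 (tr U T1 a ψ) - tr U T1 a (T0 ψ) := rfl
    rw [this, r0, r0, ← ContinuousLinearMap.integral_comp_comm _ (hU.int A0 h0 ψ),
      ← integral_sub (hU.int A0 h0 _)]
    · simp only [map_smul, smul_sub]
    · exact (tr U T1 a).integrable_comp (hU.int A0 h0 ψ)
  rw [e]
  have ib : Integrable fun x => C0 * C1 * c * ‖ψ‖ * K * ((D * W) * wt lam κ x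
      + (D * (lam ^ (-κ) * W1)) * wt lam κ x + W * wt (lam + sd a) κ x) :=
    (((iw.const_mul _).add (iw.const_mul _)).add (iws.const_mul _)).const_mul _
  refine (norm_integral_le_of_norm_le ib (Filter.Eventually.of_forall fun x => ?_)).trans
      (le_of_eq ?_)
  · rw [norm_smul]; exact inner1 x ψ
  · rw [integral_const_mul, int3 iw iw iws, hWs]
    ring

end rep

/-- Partial derivative. -/
def pd {F : Type*} [NormedAddCommGroup F] [NormedSpace ℝ F] (i : Fin 4) (f : M4 → F) : M4 → F :=
  fun x => fderiv ℝ f x (EuclideanSpace.single i 1)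

lemma pderivs_cons {F : Type*} [NormedAddCommGroup F] [NormedSpace ℝ F] (i : Fin 4)
    (α : List (Fin 4)) (f : M4 → F) : pderivs (i :: α) f = pderivs α (pd i f) := rfl

lemma pd_neg {F : Type*} [NormedAddCommGroup F] [NormedSpace ℝ F] (i : Fin 4) (f : M4 → F) :
    pd i (fun x => - f x) = fun x => - pd i f x := by
  ext x
  simp [pd, fderiv_fun_neg]

lemma pderivs_neg {F : Type*} [NormedAddCommGroup F] [NormedSpace ℝ F] (α : List (Fin 4))
    (f : M4 → F) : pderivs α (fun x => - f x) = fun x => - pderivs α f x := by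
  induction α generalizing f with
  | nil => rfl
  | cons i α ih => rw [pderivs_cons, pderivs_cons, pd_neg, ih]

lemma vec_eq (h : M4) : h = ∑ i, h i • (EuclideanSpace.single i 1 : M4) := by
  have := (EuclideanSpace.basisFun (Fin 4) ℝ).sum_repr h
  simpa using this.symm

lemma clm_apply_eq {F : Type*} [NormedAddCommGroup F] [NormedSpace ℝ F] (L : M4 →L[ℝ] F)
    (h : M4) : L h = ∑ i, h i • L (EuclideanSpace.single i 1) := by
  conv_lhs => rw [vec_eq h]
  simp

lemma clm_norm_le {F : Type*} [NormedAddCommGroup F] [NormedSpace ℝ F] (L : M4 →L[ℝ] F) :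
    ‖L‖ ≤ ∑ i, ‖L (EuclideanSpace.single i 1)‖ := by
  refine ContinuousLinearMap.opNorm_le_bound _ (by positivity) fun h => ?_
  rw [clm_apply_eq, Finset.sum_mul]
  refine (norm_sum_le _ _).trans (Finset.sum_le_sum fun i _ => ?_)
  rw [norm_smul, mul_comm]
  gcongr
  exact PiLp.norm_apply_le h i

/-- Smooth functions all of whose derivatives are bounded by the weight. -/
structure Nice (lam κ : ℝ) (f : M4 → ℂ) : Prop where
  smooth : ContDiff ℝ (⊤ : ℕ∞) f
  bd : ∀ α, ∃ C : ℝ, 0 ≤ C ∧ ∀ x, ‖pderivs α f x‖ ≤ C * wt lam κ x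

lemma nice_of {lam κ : ℝ} (hlam : 0 < lam) {f : M4 → ℂ} (hf : ContDiff ℝ (⊤ : ℕ∞) f)
    (h : ∀ α, ∃ C r : ℝ, 4 + κ ≤ r ∧ ∀ x : M4, ‖pderivs α f x‖ ≤ C * (lam + ‖x‖) ^ (-r)) :
    Nice lam κ f := by
  refine ⟨hf, fun α => ?_⟩
  obtain ⟨C, r, hr, hb⟩ := h α
  have hC : 0 ≤ C := by
    by_contra hneg
    have h1 := (norm_nonneg _).trans (hb 0)
    have h2 : 0 < (lam + ‖(0 : M4)‖) ^ (-r) := by positivity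
    nlinarith
  refine ⟨C * lam ^ (-(r - (4 + κ))), by positivity, fun x => (hb x).trans ?_⟩
  rw [mul_assoc]
  refine mul_le_mul_of_nonneg_left ?_ hC
  have hp : 0 < lam + ‖x‖ := by positivity
  have e : -r = -(r - (4 + κ)) + -(4 + κ) := by ring
  unfold wt
  rw [e, Real.rpow_add hp]
  refine mul_le_mul_of_nonneg_right ?_ (by positivity)
  exact Real.rpow_le_rpow_of_nonpos hlam (by linarith [norm_nonneg x]) (by linarith)

lemma Nice.pd {lam κ : ℝ} {f : M4 → ℂ} (hf : Nice lam κ f) (i : Fin 4) :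
    Nice lam κ (pd i f) :=
  ⟨(contDiff_infty_iff_fderiv.1 hf.smooth).2.clm_apply contDiff_const, fun α => hf.bd (i :: α)⟩

lemma Nice.neg {lam κ : ℝ} {f : M4 → ℂ} (hf : Nice lam κ f) :
    Nice lam κ (fun x => - f x) := by
  refine ⟨hf.smooth.neg, fun α => ?_⟩
  obtain ⟨C, hC, h⟩ := hf.bd α
  refine ⟨C, hC, fun x => ?_⟩
  rw [pderivs_neg, norm_neg]
  exact h x

lemma Nice.pds {lam κ : ℝ} {f : M4 → ℂ} (hf : Nice lam κ f) (α : List (Fin 4)) :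
    Nice lam κ (pderivs α f) := by
  induction α generalizing f with
  | nil => exact hf
  | cons i α ih => exact ih (hf.pd i)

lemma Nice.int {lam κ : ℝ} (hlam : 0 < lam) (hκ : 0 < κ) {f : M4 → ℂ} (hf : Nice lam κ f) :
    Integrable f := by
  obtain ⟨C, -, h⟩ := hf.bd []
  exact ((wt_int hlam hκ).const_mul C).mono' hf.smooth.continuous.aestronglyMeasurable
    (Filter.Eventually.of_forall h)

lemma Nice.fderiv_bd {lam κ : ℝ} (hlam : 0 < lam) (hκ : 0 < κ) {f : M4 → ℂ} (hf : Nice lam κ f) :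
    ∃ K : ℝ, 0 ≤ K ∧ ∀ y z : M4, ‖z - y‖ ≤ lam / 2 → ‖fderiv ℝ f z‖ ≤ K * wt lam κ y := by
  choose C hC h using fun i => hf.bd [i]
  refine ⟨(∑ i, C i) * 2 ^ (4 + κ), mul_nonneg (Finset.sum_nonneg fun i _ => hC i) (by positivity),
    fun y z hyz => ?_⟩
  refine (clm_norm_le _).trans ?_
  rw [mul_assoc, Finset.sum_mul]
  refine Finset.sum_le_sum fun i _ => (h i z).trans ?_
  refine mul_le_mul_of_nonneg_left ?_ (hC i)
  refine wt_compare hκ (by norm_num) hlam z y ?_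
  have : ‖y‖ ≤ ‖z‖ + ‖z - y‖ := by
    have := norm_sub_le z (z - y)
    simpa using this
  linarith [norm_nonneg z]

lemma Nice.taylor {lam κ : ℝ} (hlam : 0 < lam) (hκ : 0 < κ) {f : M4 → ℂ} (hf : Nice lam κ f) :
    ∃ K : ℝ, 0 ≤ K ∧ ∀ h : M4, ‖h‖ ≤ lam / 2 → ∀ y : M4,
      ‖f (y - h) + (- f y + ∑ i, (h i : ℂ) * _root_.pd i f y)‖ ≤ K * ‖h‖ ^ 2 * wt lam κ y := by
  choose K hK hb using fun i => (hf.pd i).fderiv_bd hlam hκ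
  refine ⟨∑ i, K i, Finset.sum_nonneg fun i _ => hK i, fun h hh y => ?_⟩
  have hd : Differentiable ℝ f := hf.smooth.differentiable (by simp)
  have h1 : ∀ z ∈ Metric.closedBall y ‖h‖, ‖fderiv ℝ f z - fderiv ℝ f y‖
      ≤ (∑ i, K i) * wt lam κ y * ‖h‖ := by
    intro z hz
    refine (clm_norm_le _).trans ?_
    rw [mul_assoc, Finset.sum_mul]
    refine Finset.sum_le_sum fun i _ => ?_
    have hdi : Differentiable ℝ (_root_.pd i f) := (hf.pd i).smooth.differentiable (by simp)
    have := Convex.norm_image_sub_le_of_norm_fderiv_le (𝕜 := ℝ) (f := _root_.pd i f)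
      (s := Metric.closedBall y ‖h‖) (x := y) (y := z) (fun x _ => hdi x)
      (fun x hx => hb i y x ((mem_closedBall_iff_norm.1 hx).trans hh))
      (convex_closedBall _ _) (Metric.mem_closedBall_self (norm_nonneg _)) hz
    refine this.trans ?_
    rw [mul_assoc]
    have := mem_closedBall_iff_norm.1 hz
    have := hK i
    have := wt_pos (κ := κ) hlam y
    gcongr
  have h2 := Convex.norm_image_sub_le_of_norm_fderiv_le' (𝕜 := ℝ) (f := f)
    (s := Metric.closedBall y ‖h‖) (x := y) (y := y - h) (φ := fderiv ℝ f y) (fun x _ => hd x) h1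
    (convex_closedBall _ _) (Metric.mem_closedBall_self (norm_nonneg _))
    (by simp)
  have e1 : y - h - y = -h := by abel
  rw [e1, norm_neg, map_neg, clm_apply_eq] at h2
  refine le_trans (le_of_eq ?_) (h2.trans (le_of_eq (by ring)))
  congr 1
  simp only [_root_.pd, Complex.real_smul]
  ring

section deriv
set_option linter.unusedSectionVars false
variable {H : Type*} [NormedAddCommGroup H] [InnerProductSpace ℂ H] [CompleteSpace H]
variable {U : M4 → H →L[ℂ] H}

/-- Candidate derivative of the orbit map. -/
def dtr (U : M4 → H →L[ℂ] H) (T : Fin 4 → H →L[ℂ] H) (x : M4) : M4 →L[ℝ] (H →L[ℂ] H) :=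
  ∑ i, (EuclideanSpace.proj i : M4 →L[ℝ] ℝ).smulRight (-(tr U (T i) x))

lemma dtr_apply (T : Fin 4 → H →L[ℂ] H) (x h : M4) :
    dtr U T x h = - tr U (∑ i, (h i : ℂ) • T i) x := by
  simp only [dtr, tr, _root_.sum_apply, ContinuousLinearMap.smulRight_apply,
    Finset.mul_sum, Finset.sum_mul, ← Finset.sum_neg_distrib]
  refine Finset.sum_congr rfl fun i _ => ?_
  ext ψ
  simp

lemma URep.hasFDerivAt_tr (hU : URep U) {lam κ : ℝ} (hlam : 0 < lam) (hκ : 0 < κ)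
    {A T : H →L[ℂ] H} {f : M4 → ℂ} (hf : Nice lam κ f) (hT : SmearRep U A f T)
    {T' : Fin 4 → H →L[ℂ] H} (hT' : ∀ i, SmearRep U A (pd i f) (T' i)) (x : M4) :
    HasFDerivAt (tr U T) (dtr U T' x) x := by
  rw [hasFDerivAt_iff_isLittleO_nhds_zero]
  obtain ⟨K, hK, hb⟩ := hf.taylor hlam hκ
  refine Asymptotics.IsBigO.trans_isLittleO (g := fun h : M4 => ‖h‖ ^ 2) ?_
    (Asymptotics.isLittleO_norm_pow_id (by norm_num))
  refine Asymptotics.IsBigO.of_bound (K * (∫ y, wt lam κ y) * ‖A‖) ?_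
  filter_upwards [Metric.closedBall_mem_nhds (0 : M4) (half_pos hlam)] with h hh
  have hh' : ‖h‖ ≤ lam / 2 := by simpa using hh
  have e : tr U T (x + h) - tr U T x - dtr U T' x h
      = tr U (tr U T h + (-T + ∑ i, (h i : ℂ) • T' i)) x := by
    rw [dtr_apply, hU.tr_add]
    simp only [tr, mul_add, add_mul, mul_neg, neg_mul]
    abel
  rw [e]
  refine (hU.norm_tr _ x).trans ?_
  have fi := hf.int hlam hκ
  have pi : ∀ i, Integrable fun y => (h i : ℂ) * pd i f y :=
    fun i => ((hf.pd i).int hlam hκ).const_mul _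
  have r : SmearRep U A (fun y => f (y - h) + (- f y + ∑ i, (h i : ℂ) * pd i f y))
      (tr U T h + (-T + ∑ i, (h i : ℂ) • T' i)) := by
    have isum : Integrable fun y => ∑ i, (h i : ℂ) * pd i f y :=
      integrable_finsetSum _ fun i _ => pi i
    refine hU.rep_add (fi.comp_sub_right h) (fi.neg.add isum) (hU.rep_tr fi hT h) ?_
    refine hU.rep_add fi.neg isum (rep_neg hT) ?_
    exact hU.rep_sum _ pi fun i => rep_smul (hT' i) _
  refine (hU.norm_rep_le r ((wt_int hlam hκ).const_mul (K * ‖h‖ ^ 2)) (hb h hh')).trans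
    (le_of_eq ?_)
  rw [integral_const_mul, norm_pow, norm_norm]
  ring

lemma URep.contDiff_tr (hU : URep U) {lam κ : ℝ} (hlam : 0 < lam) (hκ : 0 < κ)
    {A : H →L[ℂ] H} (n : ℕ) : ∀ {T : H →L[ℂ] H} {f : M4 → ℂ} (_ : Nice lam κ f)
    (_ : SmearRep U A f T), ContDiff ℝ n (tr U T) := by
  induction n with
  | zero =>
    intro T f hf hT
    choose T' hT' using fun i => hU.exists_rep A ((hf.pd i).int hlam hκ)
    have : Differentiable ℝ (tr U T) :=
      fun x => (hU.hasFDerivAt_tr hlam hκ hf hT hT' x).differentiableAt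
    simpa using (contDiff_zero (𝕜 := ℝ)).2 this.continuous
  | succ n ih =>
    intro T f hf hT
    choose T' hT' using fun i => hU.exists_rep A ((hf.pd i).int hlam hκ)
    push_cast
    refine contDiff_succ_iff_hasFDerivAt.2 ⟨dtr U T', ?_,
      hU.hasFDerivAt_tr hlam hκ hf hT hT'⟩
    unfold dtr
    refine ContDiff.sum fun i _ => ?_
    exact contDiff_const.smulRight (ih (hf.pd i) (hT' i)).neg

lemma URep.pd_tr (hU : URep U) {lam κ : ℝ} (hlam : 0 < lam) (hκ : 0 < κ)
    {A T : H →L[ℂ] H} {f : M4 → ℂ} (hf : Nice lam κ f) (hT : SmearRep U A f T) (i : Fin 4) :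
    ∃ S, SmearRep U A (fun x => - pd i f x) S ∧ pd i (tr U T) = tr U S := by
  choose T' hT' using fun i => hU.exists_rep A ((hf.pd i).int hlam hκ)
  refine ⟨-T' i, rep_neg (hT' i), ?_⟩
  ext1 x
  unfold pd
  rw [(hU.hasFDerivAt_tr hlam hκ hf hT hT' x).fderiv, dtr_apply]
  have : ∑ j, (((EuclideanSpace.single i 1 : M4) j : ℝ) : ℂ) • T' j = T' i := by
    rw [Finset.sum_eq_single i]
    · simp
    · intro j _ hj
      simp [hj]
    · simp
  rw [this]
  simp [tr]

lemma URep.pderivs_tr (hU : URep U) {lam κ : ℝ} (hlam : 0 < lam) (hκ : 0 < κ)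
    {A : H →L[ℂ] H} (α : List (Fin 4)) : ∀ {T : H →L[ℂ] H} {f : M4 → ℂ} (_ : Nice lam κ f)
    (_ : SmearRep U A f T),
    ∃ S, SmearRep U A (fun x => (-1) ^ α.length * pderivs α f x) S ∧
      pderivs α (tr U T) = tr U S := by
  induction α with
  | nil => intro T f hf hT; exact ⟨T, by simpa [pderivs] using hT, rfl⟩
  | cons i α ih =>
    intro T f hf hT
    obtain ⟨S, hS, e⟩ := hU.pd_tr hlam hκ hf hT i
    obtain ⟨R, hR, e'⟩ := ih (hf.pd i).neg hS
    refine ⟨R, ?_, by rw [pderivs_cons, e, e']⟩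
    rw [pderivs_neg] at hR
    simpa [pderivs_cons, pow_succ] using hR

end deriv

/-- Smearing with rapidly decreasing smooth functions produces operators with
norm-smooth orbit maps, whose derivatives are smearings with the (sign-adjusted)
derivatives of the smearing functions, and all commutators of such derivatives
are again of `κ`-type. -/
theorem stmt4 {H : Type*} [NormedAddCommGroup H] [InnerProductSpace ℂ H] [CompleteSpace H]
    (lam κ : ℝ) (hlam : 0 < lam) (hκ : 0 < κ)
    (U : M4 → H →L[ℂ] H)
    (hU0 : U 0 = 1) (hUadd : ∀ x y, U (x + y) = U x * U y)
    (hUadj : ∀ x, adjoint (U x) = U (-x)) (hUcont : ∀ ψ : H, Continuous fun x => U x ψ)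
    (A : Fin 2 → H →L[ℂ] H) (c : ℝ)
    (hcomm : ∀ a : M4,
      ‖A 0 * (U a * A 1 * U (-a)) - (U a * A 1 * U (-a)) * A 0‖ ≤ c * Dkappa lam κ a)
    (χ : Fin 2 → M4 → ℂ) (hχsm : ∀ i, ContDiff ℝ (⊤ : ℕ∞) (χ i))
    (hχb : ∀ (i : Fin 2) (α : List (Fin 4)), ∃ Cα rα : ℝ, 4 + κ ≤ rα ∧
      ∀ x : M4, ‖pderivs α (χ i) x‖ ≤ Cα * (lam + ‖x‖) ^ (-rα))
    (B : Fin 2 → H →L[ℂ] H)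
    (hB : ∀ (i : Fin 2) (ψ : H), B i ψ = ∫ x : M4, χ i x • ((U x * A i * U (-x)) ψ)) :
    (∀ i : Fin 2, ContDiff ℝ (⊤ : ℕ∞) (fun x : M4 => U x * B i * U (-x)) ∧
      ∀ (α : List (Fin 4)) (ψ : H),
        (pderivs α (fun x : M4 => U x * B i * U (-x)) 0) ψ
          = ∫ x : M4, (((-1 : ℂ) ^ α.length) * pderivs α (χ i) x) • ((U x * A i * U (-x)) ψ)) ∧
    (∀ α β : List (Fin 4), ∃ cαβ : ℝ, ∀ a : M4,
      ‖(pderivs α (fun x : M4 => U x * B 0 * U (-x)) 0) *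
          (U a * (pderivs β (fun x : M4 => U x * B 1 * U (-x)) 0) * U (-a)) -
        (U a * (pderivs β (fun x : M4 => U x * B 1 * U (-x)) 0) * U (-a)) *
          (pderivs α (fun x : M4 => U x * B 0 * U (-x)) 0)‖
        ≤ cαβ * Dkappa lam κ a) := by
  have hU : URep U := ⟨hU0, hUadd, hUadj, hUcont⟩
  have hN : ∀ i, Nice lam κ (χ i) := fun i => nice_of hlam (hχsm i) (hχb i)
  have hR : ∀ i, SmearRep U (A i) (χ i) (B i) := hB
  have key : ∀ (i : Fin 2) (α : List (Fin 4)),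
      SmearRep U (A i) (fun x => (-1) ^ α.length * pderivs α (χ i) x)
        (pderivs α (tr U (B i)) 0) := by
    intro i α
    obtain ⟨S, hS, e⟩ := hU.pderivs_tr hlam hκ α (hN i) (hR i)
    rw [e, hU.tr_zero]
    exact hS
  refine ⟨fun i => ⟨contDiff_infty.2 fun n => hU.contDiff_tr hlam hκ n (hN i) (hR i),
    fun α ψ => key i α ψ⟩, fun α β => ?_⟩
  have hb : ∀ (i : Fin 2) (α : List (Fin 4)), ∃ C : ℝ, ∀ x,
      ‖(-1) ^ α.length * pderivs α (χ i) x‖ ≤ C * wt lam κ x := by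
    intro i α
    obtain ⟨C, -, h⟩ := (hN i).bd α
    exact ⟨C, fun x => by simpa using h x⟩
  obtain ⟨C0, b0⟩ := hb 0 α
  obtain ⟨C1, b1⟩ := hb 1 β
  exact hU.comm_bound hlam hκ hcomm ((((hN 0).pds α).int hlam hκ).const_mul _)
    ((((hN 1).pds β).int hlam hκ).const_mul _) b0 b1 (key 0 α) (key 1 β)
end
end

section
/- Let λ > 0, k > 0, and let η̃ : ℝ → ℝ be a smooth even function with support contained in [−1/λ, 1/λ] and equal to 1 on [−1/(2λ), 1/(2λ)]. Define η^k₊(s) = ∫₀^∞ ω^k η̃(ω) e^{−iωs} dω. Then there is a constant C such that |η^k₊(s)| ≤ C·(λ + |s|)^{−1−k} for all s ∈ ℝ; in particular η^k₊ is integrable on ℝ. -/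
noncomputable section

open MeasureTheory

/-- `η^k₊(s) = ∫₀^∞ ω^k η̃(ω) e^{−iωs} dω`. -/
def etak (k : ℝ) (ηt : ℝ → ℝ) (s : ℝ) : ℂ :=
  ∫ ω in Set.Ioi (0 : ℝ), ((ω ^ k * ηt ω : ℝ) : ℂ) * Complex.exp (-(Complex.I * ω * s))

def GG (a : ℝ) (g : ℝ → ℂ) (s : ℝ) (ω : ℝ) : ℂ :=
  ((ω ^ a : ℝ) : ℂ) * g ω * Complex.exp (-(Complex.I * ω * s))

lemma norm_GG (a : ℝ) (g : ℝ → ℂ) (s : ℝ) (ω : ℝ) (h : 0 ≤ ω) :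
    ‖GG a g s ω‖ = ω ^ a * ‖g ω‖ := by
  have h1 : ‖Complex.exp (-(Complex.I * ω * s))‖ = 1 := by
    rw [Complex.norm_exp]; simp
  rw [GG, norm_mul, norm_mul, h1, mul_one, Complex.norm_real, Real.norm_eq_abs,
    abs_of_nonneg (Real.rpow_nonneg h a)]

lemma GG_zero_large (g : ℝ → ℂ) (hc : HasCompactSupport g) :
    ∃ R : ℝ, 0 < R ∧ ∀ x, R ≤ x → g x = 0 := by
  obtain ⟨R, hR0, hR⟩ := hc.exists_pos_le_norm
  exact ⟨R, hR0, fun x hx => hR x (hx.trans (le_abs_self x))⟩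

lemma GG_int (a c : ℝ) (hc0 : 0 ≤ c) (h : 0 < c ∨ -1 < a) (g : ℝ → ℂ) (hg : Continuous g)
    (hc : HasCompactSupport g) (s : ℝ) : IntegrableOn (GG a g s) (Set.Ioi c) := by
  obtain ⟨R, hR0, hR⟩ := GG_zero_large g hc
  have hcR : c ≤ max c R := le_max_left _ _
  rw [← Set.Ioc_union_Ioi_eq_Ioi hcR]
  refine IntegrableOn.union ?_ ?_
  · rw [← intervalIntegrable_iff_integrableOn_Ioc_of_le hcR]
    have h1 : IntervalIntegrable (fun x : ℝ => x ^ a) volume c (max c R) := by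
      rcases h with h | h
      · apply intervalIntegral.intervalIntegrable_rpow
        right
        rw [Set.uIcc_of_le hcR]
        intro h0
        exact absurd h0.1 (not_le.mpr h)
      · exact intervalIntegral.intervalIntegrable_rpow' h
    have h2 : IntervalIntegrable (fun x : ℝ => ((x ^ a : ℝ) : ℂ)) volume c (max c R) :=
      ⟨h1.1.ofReal, h1.2.ofReal⟩
    have h3 := h2.mul_continuousOn
      (g := fun ω : ℝ => g ω * Complex.exp (-(Complex.I * ω * s))) (by fun_prop)
    refine h3.congr ?_
    intro x _
    simp only [GG, mul_assoc]
  · refine (integrableOn_zero).congr_fun ?_ measurableSet_Ioi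
    intro x hx
    have : g x = 0 := hR x ((le_max_right _ _).trans (le_of_lt hx))
    simp [GG, this]

lemma GG_ibp (a c : ℝ) (hc0 : 0 ≤ c) (h : 0 < c ∨ 0 < a) (g : ℝ → ℂ)
    (hg : ContDiff ℝ (⊤ : ℕ∞) g) (hc : HasCompactSupport g) (s : ℝ) :
    Complex.I * s * ∫ ω in Set.Ioi c, GG a g s ω =
      GG a g s c + a * (∫ ω in Set.Ioi c, GG (a - 1) g s ω)
        + ∫ ω in Set.Ioi c, GG a (deriv g) s ω := by
  have hg' : Continuous (deriv g) := hg.continuous_deriv (by simp)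
  have i1 := GG_int a c hc0 (h.imp id (fun h => by linarith)) g hg.continuous hc s
  have i2 := GG_int (a-1) c hc0 (h.imp id (fun h => by linarith)) g hg.continuous hc s
  have i3 := GG_int a c hc0 (h.imp id (fun h => by linarith)) (deriv g) hg' hc.deriv s
  have hcont : ContinuousWithinAt (GG a g s) (Set.Ici c) c := by
    apply ContinuousAt.continuousWithinAt
    have h1 : ContinuousAt (fun x : ℝ => x ^ a) c :=
      Real.continuousAt_rpow_const c a (h.imp (fun h => h.ne') (fun h => h.le))
    have h2 : ContinuousAt g c := hg.continuous.continuousAt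
    unfold GG
    exact ((Complex.continuous_ofReal.continuousAt.comp h1).mul h2).mul (by fun_prop)
  have hderiv : ∀ x ∈ Set.Ioi c, HasDerivAt (GG a g s)
      (a * GG (a-1) g s x + GG a (deriv g) s x - Complex.I * s * GG a g s x) x := by
    intro x hx
    have hx0 : 0 < x := lt_of_le_of_lt hc0 hx
    have h1 : HasDerivAt (fun x : ℝ => ((x ^ a : ℝ) : ℂ)) ((a * x ^ (a-1) : ℝ) : ℂ) x :=
      (Real.hasDerivAt_rpow_const (Or.inl hx0.ne')).ofReal_comp
    have h2 : HasDerivAt g (deriv g x) x :=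
      (hg.differentiable (by simp) x).hasDerivAt
    have h3 : HasDerivAt (fun x : ℝ => -(Complex.I * x * s)) (-(Complex.I * 1 * s)) x :=
      (((Complex.ofRealCLM.hasDerivAt (x := x)).const_mul Complex.I).mul_const (s : ℂ)).neg
    have h4 := (h1.mul h2).mul h3.cexp
    refine h4.congr_deriv ?_
    simp only [GG, Pi.mul_apply]
    push_cast
    ring
  have hlim : Filter.Tendsto (GG a g s) Filter.atTop (nhds 0) := by
    obtain ⟨R, hR0, hR⟩ := GG_zero_large g hc
    apply tendsto_const_nhds.congr'
    filter_upwards [Filter.eventually_ge_atTop R] with x hx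
    simp [GG, hR x hx]
  have key := integral_Ioi_of_hasDerivAt_of_tendsto hcont hderiv
    (((i2.const_mul _).add i3).sub (i1.const_mul _)) hlim
  have j2 : IntegrableOn (fun x => (a:ℂ) * GG (a-1) g s x) (Set.Ioi c) := i2.const_mul _
  have j1 : IntegrableOn (fun x => Complex.I * s * GG a g s x) (Set.Ioi c) := i1.const_mul _
  have j23 : IntegrableOn (fun x => (a:ℂ) * GG (a-1) g s x + GG a (deriv g) s x) (Set.Ioi c) :=
    j2.add i3
  rw [integral_sub j23 j1, integral_add j2 i3, integral_const_mul, integral_const_mul] at key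
  linear_combination -key

lemma GG_base (a : ℝ) (ha : -1 < a) (ha0 : a ≤ 0) (g : ℝ → ℂ)
    (hg : ContDiff ℝ (⊤ : ℕ∞) g) (hc : HasCompactSupport g) :
    ∃ C : ℝ, ∀ s : ℝ, 1 ≤ |s| →
      ‖∫ ω in Set.Ioi (0:ℝ), GG a g s ω‖ ≤ C * |s| ^ (-(1 + a)) := by
  have hg' : Continuous (deriv g) := hg.continuous_deriv (by simp)
  obtain ⟨M, hM⟩ := hg.continuous.bounded_above_of_compact_support hc
  have hM0 : 0 ≤ M := (norm_nonneg _).trans (hM 0)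
  set D := ∫ ω in Set.Ioi (0:ℝ), ω ^ a * ‖deriv g ω‖ with hD
  have hDint : IntegrableOn (fun ω : ℝ => ω ^ a * ‖deriv g ω‖) (Set.Ioi 0) := by
    have h0 : IntegrableOn (fun ω => ‖GG a (deriv g) 0 ω‖) (Set.Ioi 0) :=
      (GG_int a 0 le_rfl (Or.inr ha) _ hg' hc.deriv 0).norm
    refine h0.congr_fun ?_ measurableSet_Ioi
    intro x hx
    exact norm_GG _ _ _ _ (le_of_lt hx)
  have hD0 : 0 ≤ D := setIntegral_nonneg measurableSet_Ioi fun x hx =>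
    mul_nonneg (Real.rpow_nonneg (le_of_lt hx) _) (norm_nonneg _)
  refine ⟨M / (a + 1) + 2 * M + D, fun s hs => ?_⟩
  have hs0 : 0 < |s| := by linarith
  set c := |s|⁻¹ with hcdef
  have hc0 : 0 < c := inv_pos.mpr hs0
  have hc1 : c ≤ 1 := inv_le_one_of_one_le₀ hs
  have hpow : |s| ^ (-(1 + a)) = c * c ^ a := by
    rw [Real.rpow_neg hs0.le, ← Real.inv_rpow hs0.le, Real.rpow_add hc0, Real.rpow_one]
  have hca : 1 ≤ c ^ a := Real.one_le_rpow_of_pos_of_le_one_of_nonpos hc0 hc1 ha0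
  have i0 := GG_int a 0 le_rfl (Or.inr ha) g hg.continuous hc s
  have hsplit : ∫ ω in Set.Ioi (0:ℝ), GG a g s ω =
      (∫ ω in Set.Ioc 0 c, GG a g s ω) + ∫ ω in Set.Ioi c, GG a g s ω := by
    rw [← Set.Ioc_union_Ioi_eq_Ioi hc0.le]
    exact setIntegral_union (Set.Ioc_disjoint_Ioi le_rfl) measurableSet_Ioi
      (i0.mono_set Set.Ioc_subset_Ioi_self) (i0.mono_set (Set.Ioi_subset_Ioi hc0.le))
  have hfirst : ‖∫ ω in Set.Ioc 0 c, GG a g s ω‖ ≤ M / (a + 1) * (c * c ^ a) := by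
    have hi : IntegrableOn (fun x : ℝ => x ^ a * M) (Set.Ioc 0 c) := by
      rw [← intervalIntegrable_iff_integrableOn_Ioc_of_le hc0.le]
      exact (intervalIntegral.intervalIntegrable_rpow' ha).mul_const M
    have h1 : ‖∫ ω in Set.Ioc 0 c, GG a g s ω‖ ≤ ∫ ω in Set.Ioc 0 c, ω ^ a * M := by
      refine norm_integral_le_of_norm_le hi ?_
      filter_upwards [ae_restrict_mem measurableSet_Ioc] with x hx
      rw [norm_GG _ _ _ _ hx.1.le]
      exact mul_le_mul_of_nonneg_left (hM x) (Real.rpow_nonneg hx.1.le _)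
    rw [integral_mul_const,
      ← intervalIntegral.integral_of_le (f := fun x : ℝ => x ^ a) hc0.le, integral_rpow (Or.inl ha), Real.zero_rpow (by linarith), Real.rpow_add hc0,
      Real.rpow_one] at h1
    refine h1.trans (le_of_eq ?_)
    ring
  have hsecond : ‖∫ ω in Set.Ioi c, GG a g s ω‖ ≤ (2 * M + D) * (c * c ^ a) := by
    have hibp := congrArg norm (GG_ibp a c hc0.le (Or.inl hc0) g hg hc s)
    rw [norm_mul, norm_mul, Complex.norm_I, one_mul, Complex.norm_real, Real.norm_eq_abs] at hibp
    have e1 : ‖GG a g s c‖ ≤ c ^ a * M := by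
      rw [norm_GG _ _ _ _ hc0.le]
      exact mul_le_mul_of_nonneg_left (hM c) (Real.rpow_nonneg hc0.le _)
    have e2 : ‖(a:ℂ) * ∫ ω in Set.Ioi c, GG (a-1) g s ω‖ ≤ c ^ a * M := by
      rcases eq_or_lt_of_le ha0 with h0 | h0
      · rw [h0]; simpa using hM0
      · have h1 : ‖∫ ω in Set.Ioi c, GG (a-1) g s ω‖ ≤ ∫ ω in Set.Ioi c, ω ^ (a-1) * M := by
          refine norm_integral_le_of_norm_le
            ((integrableOn_Ioi_rpow_of_lt (by linarith) hc0).mul_const M) ?_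
          filter_upwards [ae_restrict_mem measurableSet_Ioi] with x hx
          have hx0 : 0 ≤ x := hc0.le.trans (le_of_lt hx)
          rw [norm_GG _ _ _ _ hx0]
          exact mul_le_mul_of_nonneg_left (hM x) (Real.rpow_nonneg hx0 _)
        rw [integral_mul_const, integral_Ioi_rpow_of_lt (by linarith) hc0, sub_add_cancel] at h1
        rw [norm_mul, Complex.norm_real, Real.norm_eq_abs, abs_of_neg h0]
        refine (mul_le_mul_of_nonneg_left h1 (by linarith)).trans (le_of_eq ?_)
        have := h0.ne
        field_simp
    have e3 : ‖∫ ω in Set.Ioi c, GG a (deriv g) s ω‖ ≤ D := by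
      have h1 : ‖∫ ω in Set.Ioi c, GG a (deriv g) s ω‖
          ≤ ∫ ω in Set.Ioi c, ω ^ a * ‖deriv g ω‖ := by
        refine norm_integral_le_of_norm_le (hDint.mono_set (Set.Ioi_subset_Ioi hc0.le)) ?_
        filter_upwards [ae_restrict_mem measurableSet_Ioi] with x hx
        rw [norm_GG _ _ _ _ (hc0.le.trans (le_of_lt hx))]
      refine h1.trans (setIntegral_mono_set hDint ?_
        (Set.Ioi_subset_Ioi hc0.le).eventuallyLE)
      filter_upwards [ae_restrict_mem measurableSet_Ioi] with x hx
      exact mul_nonneg (Real.rpow_nonneg (le_of_lt hx) _) (norm_nonneg _)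
    have e4 : |s| * ‖∫ ω in Set.Ioi c, GG a g s ω‖ ≤ (2 * M + D) * c ^ a := by
      rw [hibp]
      refine (norm_add₃_le).trans ?_
      nlinarith
    have hcs : c * |s| = 1 := inv_mul_cancel₀ hs0.ne'
    calc ‖∫ ω in Set.Ioi c, GG a g s ω‖
        = c * (|s| * ‖∫ ω in Set.Ioi c, GG a g s ω‖) := by rw [← mul_assoc, hcs, one_mul]
      _ ≤ c * ((2 * M + D) * c ^ a) := mul_le_mul_of_nonneg_left e4 hc0.le
      _ = _ := by ring
  rw [hsplit, hpow]
  refine (norm_add_le _ _).trans ?_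
  linarith

lemma GG_bound (n : ℕ) : ∀ (a : ℝ) (_ : -1 < a) (_ : a ≤ n) (g : ℝ → ℂ)
    (_ : ContDiff ℝ (⊤ : ℕ∞) g) (_ : HasCompactSupport g),
    ∃ C : ℝ, ∀ s : ℝ, 1 ≤ |s| →
      ‖∫ ω in Set.Ioi (0:ℝ), GG a g s ω‖ ≤ C * |s| ^ (-(1 + a)) := by
  induction n with
  | zero =>
    intro a ha ha0 g hg hc
    exact GG_base a ha (by simpa using ha0) g hg hc
  | succ n ih =>
    intro a ha han g hg hc
    rcases le_or_gt a 0 with h0 | h0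
    · exact GG_base a ha h0 g hg hc
    push_cast at han
    have hd : ContDiff ℝ (⊤ : ℕ∞) (deriv g) := by
      exact (contDiff_infty_iff_deriv.mp hg).2
    have hd2 : ContDiff ℝ (⊤ : ℕ∞) (fun x : ℝ => (x : ℂ) * deriv g x) :=
      Complex.ofRealCLM.contDiff.mul hd
    obtain ⟨C1, h1⟩ := ih (a - 1) (by linarith) (by linarith) g hg hc
    obtain ⟨C2, h2⟩ := ih (a - 1) (by linarith) (by linarith) _ hd2 (hc.deriv.mul_left)
    refine ⟨a * C1 + C2, fun s hs => ?_⟩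
    have hs0 : 0 < |s| := by linarith
    have hibp := congrArg norm (GG_ibp a 0 le_rfl (Or.inr h0) g hg hc s)
    have hz : GG a g s 0 = 0 := by simp [GG, Real.zero_rpow h0.ne']
    have he : ∫ ω in Set.Ioi (0:ℝ), GG a (deriv g) s ω =
        ∫ ω in Set.Ioi (0:ℝ), GG (a - 1) (fun x : ℝ => (x : ℂ) * deriv g x) s ω := by
      refine setIntegral_congr_fun measurableSet_Ioi fun x hx => ?_
      have hx0 : (0:ℝ) < x := hx
      have : x ^ a = x ^ (a - 1) * x := by
        rw [Real.rpow_sub_one hx0.ne', div_mul_cancel₀ _ hx0.ne']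
      simp only [GG, this]
      push_cast
      ring
    rw [norm_mul, norm_mul, Complex.norm_I, one_mul, Complex.norm_real, Real.norm_eq_abs,
      hz, zero_add, he] at hibp
    have b1 := h1 s hs
    have b2 := h2 s hs
    have e : -(1 + (a - 1)) = -(1 + a) + 1 := by ring
    rw [e, Real.rpow_add_one hs0.ne'] at b1 b2
    have b3 := norm_add_le ((a:ℂ) * ∫ ω in Set.Ioi (0:ℝ), GG (a - 1) g s ω)
      (∫ ω in Set.Ioi (0:ℝ), GG (a - 1) (fun x : ℝ => (x : ℂ) * deriv g x) s ω)
    rw [← hibp, norm_mul, Complex.norm_real, Real.norm_eq_abs, abs_of_pos h0] at b3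
    have b4 := mul_le_mul_of_nonneg_left b1 h0.le
    refine le_of_mul_le_mul_left ?_ hs0
    linarith

/-- Decay of `η^k₊`: there is a constant `C` with `|η^k₊(s)| ≤ C (λ + |s|)^{−1−k}`;
in particular `η^k₊` is integrable on `ℝ`. -/
theorem stmt7 (lam k : ℝ) (hlam : 0 < lam) (hk : 0 < k)
    (ηt : ℝ → ℝ) (hsm : ContDiff ℝ (⊤ : ℕ∞) ηt) (heven : ∀ ω, ηt (-ω) = ηt ω)
    (hsupp : Function.support ηt ⊆ Set.Icc (-(1 / lam)) (1 / lam))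
    (hone : ∀ ω ∈ Set.Icc (-(1 / (2 * lam))) (1 / (2 * lam)), ηt ω = 1) :
    (∃ C : ℝ, ∀ s : ℝ, ‖etak k ηt s‖ ≤ C * (lam + |s|) ^ (-(1 + k))) ∧
    Integrable (etak k ηt) := by
  set g : ℝ → ℂ := fun x => (ηt x : ℂ) with hgdef
  have hg : ContDiff ℝ (⊤ : ℕ∞) g := Complex.ofRealCLM.contDiff.comp hsm
  have hc : HasCompactSupport g := by
    refine HasCompactSupport.of_support_subset_isCompact
      (isCompact_Icc (a := -(1 / lam)) (b := 1 / lam)) ?_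
    intro x hx
    refine hsupp ?_
    intro h
    exact hx (by simp [hgdef, h])
  have heq : ∀ s, etak k ηt s = ∫ ω in Set.Ioi (0:ℝ), GG k g s ω := by
    intro s
    simp only [etak, GG, hgdef]
    push_cast
    rfl
  obtain ⟨n, hn⟩ := exists_nat_ge k
  obtain ⟨C, hC⟩ := GG_bound n k (by linarith) hn g hg hc
  have hB : ∀ s, ‖etak k ηt s‖ ≤ ∫ ω in Set.Ioi (0:ℝ), ‖GG k g 0 ω‖ := by
    intro s
    rw [heq]
    refine (norm_integral_le_integral_norm _).trans (le_of_eq ?_)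
    refine setIntegral_congr_fun measurableSet_Ioi fun x hx => ?_
    rw [norm_GG _ _ _ _ (le_of_lt hx), norm_GG _ _ _ _ (le_of_lt hx)]
  set B := ∫ ω in Set.Ioi (0:ℝ), ‖GG k g 0 ω‖
  have hbound : ∀ s : ℝ, ‖etak k ηt s‖ ≤
      (max B C * (lam + 1) ^ (1 + k)) * (lam + |s|) ^ (-(1 + k)) := by
    intro s
    have hB0 : 0 ≤ B := (norm_nonneg _).trans (hB s)
    have hmax : 0 ≤ max B C := hB0.trans (le_max_left _ _)
    have hp : 0 < lam + |s| := by positivity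
    rw [mul_assoc, Real.rpow_neg hp.le, ← div_eq_mul_inv,
      ← Real.div_rpow (by linarith) hp.le]
    rcases le_total 1 |s| with h | h
    · have hs0 : 0 < |s| := by linarith
      rw [heq]
      refine (hC s h).trans ?_
      rw [Real.rpow_neg hs0.le, ← Real.inv_rpow hs0.le]
      have : |s|⁻¹ ≤ (lam + 1) / (lam + |s|) := by
        rw [inv_eq_one_div, div_le_div_iff₀ hs0 hp]
        nlinarith
      refine mul_le_mul (le_max_right _ _) ?_ (by positivity) hmax
      exact Real.rpow_le_rpow (by positivity) this (by linarith)
    · have h1 : 1 ≤ (lam + 1) / (lam + |s|) := by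
        rw [le_div_iff₀ hp]; linarith
      have h2 := Real.one_le_rpow h1 (show 0 ≤ 1 + k by linarith)
      calc _ ≤ B := hB s
        _ ≤ max B C := le_max_left _ _
        _ ≤ _ := le_mul_of_one_le_right hmax h2
  refine ⟨⟨_, hbound⟩, ?_⟩
  have hmeas : AEStronglyMeasurable (etak k ηt) volume := by
    have hm : StronglyMeasurable (fun p : ℝ × ℝ => GG k g p.1 p.2) := by
      apply Measurable.stronglyMeasurable
      have : Measurable g := hg.continuous.measurable
      unfold GG
      fun_prop
    have h := hm.integral_prod_right' (ν := volume.restrict (Set.Ioi (0:ℝ)))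
    have h' : etak k ηt = fun s => ∫ ω in Set.Ioi (0:ℝ), GG k g s ω := funext heq
    rw [h']
    exact h.aestronglyMeasurable
  set K := max B C * (lam + 1) ^ (1 + k)
  have hK : 0 ≤ K := by
    have hB0 : 0 ≤ B := (norm_nonneg _).trans (hB 0)
    have hmax : 0 ≤ max B C := hB0.trans (le_max_left _ _)
    positivity
  have hint : Integrable (fun s : ℝ => (1 + ‖s‖) ^ (-(1 + k))) :=
    integrable_one_add_norm (by simp; linarith)
  refine (hint.const_mul (K * (min lam 1) ^ (-(1 + k)))).mono' hmeas ?_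
  filter_upwards with s
  refine (hbound s).trans ?_
  have hm : 0 < min lam 1 := lt_min hlam one_pos
  rw [mul_assoc K, ← Real.mul_rpow hm.le (by positivity)]
  refine mul_le_mul_of_nonneg_left ?_ hK
  refine Real.rpow_le_rpow_of_nonpos (by positivity) ?_ (by linarith)
  rw [Real.norm_eq_abs]
  have := min_le_left lam 1
  have := min_le_right lam 1
  nlinarith [abs_nonneg s]
end
end

section
/- Let B be a bounded operator on H satisfying ‖[B*, B(x)]‖ ≤ c·D_κ(x) for all x ∈ ℝ⁴. Let k > 0 and let g : ℝ → ℂ satisfy, for every N ∈ ℕ, a bound |g(τ)| ≤ C_N·(1 + |τ|/λ)^{−N}. For each integer n ≥ 0 set g_n(τ) = 2^{−n(k+1)}·g(2^{−n}τ) and let B_n be the bounded operator B_nψ = ∫ g_n(τ)·B(τ·e₀)ψ dτ, where e₀ = (1,0,0,0). Then there exists a constant C such that for all n ≥ 0 and all a ∈ ℝ⁴: ‖[B_n*, B_n(a)]‖ ≤ C·2^{−n(2k−κ)}·D_κ(a). -/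
noncomputable section

open ContinuousLinearMap MeasureTheory

/-- The time-axis unit vector `e₀ = (1,0,0,0)`. -/
def e0 : M4 := EuclideanSpace.single 0 1

theorem aux_comm_bound {H : Type*} [NormedAddCommGroup H] [InnerProductSpace ℂ H] [CompleteSpace H]
    (f : ℝ → ℂ) (S : ℝ → H →L[ℂ] H) (T X : H →L[ℂ] H)
    (hint : ∀ ψ, Integrable (fun τ => f τ • S τ ψ))
    (hT : ∀ ψ, T ψ = ∫ τ, f τ • S τ ψ) (h : ℝ → ℝ) (hh0 : ∀ τ, 0 ≤ h τ)
    (hh : ∀ τ, ‖X * S τ - S τ * X‖ ≤ h τ)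
    (hI : Integrable (fun τ => ‖f τ‖ * h τ)) :
    ‖X * T - T * X‖ ≤ ∫ τ, ‖f τ‖ * h τ := by
  refine ContinuousLinearMap.opNorm_le_bound _
    (integral_nonneg fun τ => mul_nonneg (norm_nonneg _) (hh0 τ)) fun ψ => ?_
  have e : (X * T - T * X) ψ = ∫ τ, f τ • ((X * S τ - S τ * X) ψ) := by
    have h1 : X (T ψ) = ∫ τ, X (f τ • S τ ψ) := by
      rw [hT, ContinuousLinearMap.integral_comp_comm X (hint ψ)]
    have h2 : T (X ψ) = ∫ τ, f τ • S τ (X ψ) := hT _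
    change X (T ψ) - T (X ψ) = _
    rw [h1, h2, ← integral_sub (X.integrable_comp (hint ψ)) (hint (X ψ))]
    congr 1; ext τ
    simp [smul_sub]
  rw [e, ← integral_mul_const]
  refine norm_integral_le_of_norm_le (hI.mul_const _) (Filter.Eventually.of_forall fun τ => ?_)
  rw [norm_smul, mul_assoc]
  gcongr
  exact (ContinuousLinearMap.le_opNorm _ _).trans
    (mul_le_mul_of_nonneg_right (hh τ) (norm_nonneg _))

theorem aux_D_eq (lam κ : ℝ) (hlam : 0 < lam) (a : M4) :
    Dkappa lam κ a = (lam / (lam + max (snorm3 a - |a 0|) 0)) ^ κ := by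
  have hs : 0 ≤ snorm3 a := Real.sqrt_nonneg _
  unfold Dkappa
  split_ifs with h
  · rw [sq_le_sq, abs_of_nonneg hs] at h
    rw [max_eq_right (by linarith), add_zero, div_self hlam.ne', Real.one_rpow]
  · rw [sq_le_sq, abs_of_nonneg hs, not_le] at h
    rw [max_eq_left (by linarith), Real.div_rpow hlam.le (by linarith), add_sub_assoc]

theorem aux_D_shift (lam κ : ℝ) (hlam : 0 < lam) (hκ : 0 < κ) (a : M4) (s : ℝ) :
    Dkappa lam κ (a + s • e0) ≤ (1 + |s| / lam) ^ κ * Dkappa lam κ a := by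
  rw [aux_D_eq lam κ hlam, aux_D_eq lam κ hlam]
  have h1 : snorm3 (a + s • e0) = snorm3 a := by simp [snorm3, e0]
  have h0 : (a + s • e0) 0 = a 0 + s := by simp [e0]
  rw [h1, h0]
  have hm : 0 ≤ max (snorm3 a - |a 0|) 0 := le_max_right _ _
  have hm' : 0 ≤ max (snorm3 a - |a 0 + s|) 0 := le_max_right _ _
  rw [← Real.mul_rpow (by positivity) (by positivity)]
  refine Real.rpow_le_rpow (by positivity) ?_ hκ.le
  have key : max (snorm3 a - |a 0|) 0 ≤ max (snorm3 a - |a 0 + s|) 0 + |s| := by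
    refine max_le ?_ (by positivity)
    have := abs_add_le (a 0) s
    have := le_max_left (snorm3 a - |a 0 + s|) 0
    linarith
  rw [← mul_div_assoc, div_le_div_iff₀ (by positivity) (by positivity)]
  have e : (1 + |s| / lam) * lam = lam + |s| := by field_simp
  rw [e]
  nlinarith [mul_nonneg (abs_nonneg s) hm']

theorem aux_w (lam κ : ℝ) (hlam : 0 < lam) (hκ : 0 < κ) (r : ℝ) (hr : 0 < r) (hr1 : r ≤ 1)
    (x y : ℝ) :
    (1 + |y - x| / lam) ^ κ ≤
      (r⁻¹) ^ κ * ((1 + |r * x| / lam) ^ κ * (1 + |r * y| / lam) ^ κ) := by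
  rw [← Real.mul_rpow (by positivity) (by positivity),
    ← Real.mul_rpow (by positivity) (by positivity)]
  refine Real.rpow_le_rpow (by positivity) ?_ hκ.le
  rw [inv_mul_eq_div, le_div_iff₀ hr, abs_mul, abs_mul, abs_of_pos hr]
  have h1 : |y - x| ≤ |y| + |x| := abs_sub _ _
  have h2 : |y - x| / lam ≤ |y| / lam + |x| / lam := by
    rw [← add_div]; gcongr
  have h3 := mul_le_mul_of_nonneg_left h2 hr.le
  rw [mul_div_assoc, mul_div_assoc]
  have : 0 ≤ (r * (|x| / lam)) * (r * (|y| / lam)) := by positivity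
  nlinarith

theorem aux_int (lam κ : ℝ) (hlam : 0 < lam) (hκ : 0 < κ) (g : ℝ → ℂ) (hgm : Measurable g)
    (hg : ∀ N : ℕ, ∃ CN : ℝ, ∀ τ : ℝ, ‖g τ‖ ≤ CN * (1 + |τ| / lam) ^ (-(N : ℝ))) :
    Integrable (fun τ => ‖g τ‖ * (1 + |τ| / lam) ^ κ) := by
  obtain ⟨N, hN⟩ := exists_nat_ge (κ + 2)
  obtain ⟨CN, hC⟩ := hg N
  have h1 : Integrable (fun x : ℝ => (1 + ‖x‖) ^ (-(2:ℝ))) :=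
    integrable_one_add_norm (by simp)
  have h2 := (h1.comp_div hlam.ne').const_mul CN
  have hC0 : 0 ≤ CN := by
    have := (norm_nonneg _).trans (hC 0)
    simpa using this
  refine h2.mono' (by fun_prop) (Filter.Eventually.of_forall fun τ => ?_)
  have hp : 1 ≤ 1 + |τ| / lam := by
    have : 0 ≤ |τ| / lam := by positivity
    linarith
  rw [Real.norm_of_nonneg (by positivity)]
  calc ‖g τ‖ * (1 + |τ| / lam) ^ κ
      ≤ CN * (1 + |τ| / lam) ^ (-(N : ℝ)) * (1 + |τ| / lam) ^ κ := by
        gcongr; exact hC τ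
    _ = CN * (1 + |τ| / lam) ^ (-(N : ℝ) + κ) := by
        rw [mul_assoc, Real.rpow_add (by positivity)]
    _ ≤ CN * (1 + ‖τ / lam‖) ^ (-(2:ℝ)) := by
        rw [norm_div, Real.norm_eq_abs, Real.norm_of_nonneg hlam.le]
        gcongr
        linarith


/-- If `‖[B*, B(x)]‖ ≤ c·D_κ(x)` and `g` decays faster than any inverse power, then the
operators `B_n` obtained by time-smearing `B` with `g_n(τ) = 2^{−n(k+1)} g(2^{−n}τ)` satisfy
`‖[B_n*, B_n(a)]‖ ≤ C 2^{−n(2k−κ)} D_κ(a)` uniformly in `n` and `a`. -/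
theorem stmt9 {H : Type*} [NormedAddCommGroup H] [InnerProductSpace ℂ H] [CompleteSpace H]
    (lam κ k : ℝ) (hlam : 0 < lam) (hκ : 0 < κ) (hk : 0 < k)
    (U : M4 → H →L[ℂ] H)
    (hU0 : U 0 = 1) (hUadd : ∀ x y, U (x + y) = U x * U y)
    (hUadj : ∀ x, adjoint (U x) = U (-x)) (hUcont : ∀ ψ : H, Continuous fun x => U x ψ)
    (B : H →L[ℂ] H) (c : ℝ)
    (hcomm : ∀ x : M4, ‖adjoint B * (U x * B * U (-x)) - (U x * B * U (-x)) * adjoint B‖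
        ≤ c * Dkappa lam κ x)
    (g : ℝ → ℂ) (hgm : Measurable g)
    (hg : ∀ N : ℕ, ∃ CN : ℝ, ∀ τ : ℝ, ‖g τ‖ ≤ CN * (1 + |τ| / lam) ^ (-(N : ℝ)))
    (Bn : ℕ → H →L[ℂ] H)
    (hBn : ∀ (n : ℕ) (ψ : H), Bn n ψ =
      ∫ τ : ℝ, ((((2 : ℝ) ^ (-((n : ℝ) * (k + 1))) : ℝ) : ℂ) * g ((2 : ℝ) ^ (-(n : ℝ)) * τ)) •
        ((U (τ • e0) * B * U (-(τ • e0))) ψ)) :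
    ∃ C : ℝ, ∀ (n : ℕ) (a : M4),
      ‖adjoint (Bn n) * (U a * Bn n * U (-a)) - (U a * Bn n * U (-a)) * adjoint (Bn n)‖
        ≤ C * (2 : ℝ) ^ (-((n : ℝ) * (2 * k - κ))) * Dkappa lam κ a := by
  have hUiso : ∀ x ψ, ‖U x ψ‖ = ‖ψ‖ := by
    intro x ψ
    have h1 : adjoint (U x) * U x = 1 := by rw [hUadj, ← hUadd, neg_add_cancel, hU0]
    have h2 : ‖U x ψ‖ ^ 2 = ‖ψ‖ ^ 2 := by
      have := ContinuousLinearMap.apply_norm_sq_eq_inner_adjoint_left (U x) ψ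
      rw [this]
      change RCLike.re (inner ℂ ((adjoint (U x) * U x) ψ) ψ) = _
      rw [h1]; exact inner_self_eq_norm_sq (𝕜 := ℂ) ψ
    exact (sq_eq_sq₀ (norm_nonneg _) (norm_nonneg _)).1 h2
  have hUn : ∀ x, ‖U x‖ ≤ 1 := fun x =>
    ContinuousLinearMap.opNorm_le_bound _ zero_le_one fun ψ => by rw [hUiso, one_mul]
  have hUU : ∀ x, U (-x) * U x = 1 := fun x => by rw [← hUadd, neg_add_cancel, hU0]
  let cj : M4 → (H →L[ℂ] H) → (H →L[ℂ] H) := fun x A => U x * A * U (-x)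
  have cj_def : ∀ x A, cj x A = U x * A * U (-x) := fun x A => rfl
  have cj_norm : ∀ x A, ‖cj x A‖ ≤ ‖A‖ := by
    intro x A
    refine ContinuousLinearMap.opNorm_le_bound _ (norm_nonneg _) fun ψ => ?_
    change ‖U x (A (U (-x) ψ))‖ ≤ _
    rw [hUiso]
    exact (A.le_opNorm _).trans (by rw [hUiso])
  have cj_cj : ∀ x y A, cj x (cj y A) = cj (x + y) A := by
    intro x y A
    simp only [cj_def]
    rw [hUadd x y, neg_add_rev, hUadd (-y) (-x)]
    simp only [mul_assoc]
  have cj_mul : ∀ x A C, cj x (A * C) = cj x A * cj x C := by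
    intro x A C
    simp only [cj_def]
    calc U x * (A * C) * U (-x) = U x * A * 1 * C * U (-x) := by simp only [mul_assoc, one_mul]
      _ = _ := by rw [← hUU x]; simp only [mul_assoc]
  have cj_sub : ∀ x A C, cj x (A - C) = cj x A - cj x C := by
    intro x A C
    simp only [cj_def, mul_sub, sub_mul]
  have adj_mul : ∀ A C : H →L[ℂ] H, adjoint (A * C) = adjoint C * adjoint A :=
    fun A C => ContinuousLinearMap.adjoint_comp A C
  have cj_adj : ∀ x A, adjoint (cj x A) = cj x (adjoint A) := by
    intro x A
    simp only [cj_def, adj_mul, hUadj, neg_neg, mul_assoc]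
  have comm_swap : ∀ X Y : H →L[ℂ] H,
      ‖adjoint X * Y - Y * adjoint X‖ = ‖adjoint Y * X - X * adjoint Y‖ := by
    intro X Y
    rw [← LinearIsometryEquiv.norm_map adjoint (adjoint X * Y - Y * adjoint X), map_sub,
      adj_mul, adj_mul, adjoint_adjoint]
  have hc : 0 ≤ c := by
    have h := (norm_nonneg _).trans (hcomm 0)
    simpa [Dkappa, snorm3] using h
  have hD0 : ∀ a, 0 ≤ Dkappa lam κ a := fun a => by
    rw [aux_D_eq lam κ hlam]
    have : 0 ≤ max (snorm3 a - |a 0|) 0 := le_max_right _ _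
    positivity
  have hcomm2 : ∀ y z, ‖adjoint (cj y B) * cj z B - cj z B * adjoint (cj y B)‖
      ≤ c * Dkappa lam κ (z - y) := by
    intro y z
    have e : adjoint (cj y B) * cj z B - cj z B * adjoint (cj y B)
        = cj y (adjoint B * cj (z - y) B - cj (z - y) B * adjoint B) := by
      rw [cj_sub, cj_mul y (adjoint B) (cj (z - y) B), cj_mul y (cj (z - y) B) (adjoint B),
        cj_cj, cj_adj, add_sub_cancel]
    rw [e]
    exact (cj_norm _ _).trans (hcomm _)
  have hcont : ∀ (a : M4) ψ, Continuous fun τ : ℝ => cj (a + τ • e0) B ψ := by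
    intro a ψ
    have hx : Continuous fun τ : ℝ => a + τ • e0 := by fun_prop
    have hv : Continuous fun τ : ℝ => B (U (-(a + τ • e0)) ψ) :=
      B.continuous.comp ((hUcont ψ).comp hx.neg)
    change Continuous fun τ : ℝ => U (a + τ • e0) (B (U (-(a + τ • e0)) ψ))
    generalize (fun τ : ℝ => a + τ • e0) = x at hx
    rw [continuous_iff_continuousAt]
    intro t
    rw [ContinuousAt, tendsto_iff_norm_sub_tendsto_zero]
    set v : ℝ → H := fun τ : ℝ => B (U (-(a + τ • e0)) ψ) with hvdef
    have l1 : Filter.Tendsto (fun τ => ‖v τ - v t‖) (nhds t) (nhds 0) :=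
      tendsto_iff_norm_sub_tendsto_zero.1 hv.continuousAt
    have hx' : Continuous fun τ : ℝ => a + τ • e0 := by fun_prop
    have l2 : Filter.Tendsto (fun τ => ‖U (a + τ • e0) (v t) - U (a + t • e0) (v t)‖)
        (nhds t) (nhds 0) :=
      tendsto_iff_norm_sub_tendsto_zero.1 ((hUcont (v t)).comp hx').continuousAt
    refine squeeze_zero (fun _ => norm_nonneg _) (fun τ => ?_) (by simpa using l1.add l2)
    have : U (a + τ • e0) (v τ) - U (a + t • e0) (v t)
      = U (a + τ • e0) (v τ - v t) + (U (a + τ • e0) (v t) - U (a + t • e0) (v t)) := by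
      rw [map_sub]; abel
    change ‖U (a + τ • e0) (v τ) - U (a + t • e0) (v t)‖ ≤ _
    rw [this]
    refine (norm_add_le _ _).trans ?_
    rw [hUiso]
  have hG := aux_int lam κ hlam hκ g hgm hg
  set w : ℝ → ℝ := fun τ => (1 + |τ| / lam) ^ κ with hw
  have hw1 : ∀ τ, 1 ≤ w τ := fun τ => by
    refine Real.one_le_rpow ?_ hκ.le
    have : 0 ≤ |τ| / lam := by positivity
    linarith
  have hgI : Integrable g := by
    refine hG.mono' hgm.aestronglyMeasurable (Filter.Eventually.of_forall fun τ => ?_)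
    exact le_mul_of_one_le_right (norm_nonneg _) (hw1 τ)
  set G : ℝ := ∫ τ, ‖g τ‖ * (1 + |τ| / lam) ^ κ with hGdef
  refine ⟨c * G ^ 2, fun n a => ?_⟩
  set p : ℝ := (2 : ℝ) ^ (-((n : ℝ) * (k + 1))) with hp
  set r : ℝ := (2 : ℝ) ^ (-(n : ℝ)) with hr
  have hp0 : 0 < p := by positivity
  have hr0 : 0 < r := by positivity
  have hr1 : r ≤ 1 := Real.rpow_le_one_of_one_le_of_nonpos (by norm_num) (by simp)
  set f : ℝ → ℂ := fun τ => ((p : ℝ) : ℂ) * g (r * τ) with hf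
  have hfI : Integrable f := (hgI.comp_mul_left' hr0.ne').const_mul _
  have hfw : ∀ τ, ‖f τ‖ * w (r * τ) = p * (‖g (r * τ)‖ * w (r * τ)) := by
    intro τ
    simp only [hf, norm_mul, Complex.norm_real, Real.norm_of_nonneg hp0.le, mul_assoc]
  have hfwI : Integrable (fun τ => ‖f τ‖ * w (r * τ)) := by
    simp_rw [hfw]
    exact (hG.comp_mul_left' hr0.ne').const_mul p
  have hfwint : ∫ τ, ‖f τ‖ * w (r * τ) = p * (r⁻¹ * G) := by
    simp_rw [hfw]
    rw [integral_const_mul, Measure.integral_comp_mul_left (fun τ => ‖g τ‖ * w τ) r,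
      abs_of_pos (inv_pos.2 hr0), smul_eq_mul]
  have hint : ∀ (b : M4) ψ, Integrable (fun τ => f τ • cj (b + τ • e0) B ψ) := by
    intro b ψ
    refine (hfI.norm.mul_const (‖B‖ * ‖ψ‖)).mono'
      (hfI.aestronglyMeasurable.smul (hcont b ψ).aestronglyMeasurable)
      (Filter.Eventually.of_forall fun τ => ?_)
    rw [norm_smul]
    gcongr
    exact (ContinuousLinearMap.le_opNorm _ _).trans
      (mul_le_mul_of_nonneg_right (cj_norm _ _) (norm_nonneg _))
  have hT0 : ∀ ψ, Bn n ψ = ∫ τ, f τ • cj ((0 : M4) + τ • e0) B ψ := by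
    intro ψ
    simp only [zero_add]
    exact hBn n ψ
  have hTa : ∀ ψ, cj a (Bn n) ψ = ∫ τ, f τ • cj (a + τ • e0) B ψ := by
    intro ψ
    change U a (Bn n (U (-a) ψ)) = _
    rw [hT0, ← ContinuousLinearMap.integral_comp_comm (U a) (hint 0 _)]
    congr 1; ext τ
    rw [← cj_cj a (τ • e0) B, map_smul, zero_add]
    rfl
  set K : ℝ := c * Dkappa lam κ a * (r⁻¹) ^ κ with hK
  have hK0 : 0 ≤ K := by have := hD0 a; positivity
  have hw0 : ∀ τ, 0 ≤ w τ := fun τ => zero_le_one.trans (hw1 τ)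
  have hkey : ∀ x y : ℝ, ‖adjoint (cj ((0 : M4) + x • e0) B) * cj (a + y • e0) B
      - cj (a + y • e0) B * adjoint (cj ((0 : M4) + x • e0) B)‖
      ≤ (K * w (r * x)) * w (r * y) := by
    intro x y
    refine (hcomm2 _ _).trans ?_
    have e : a + y • e0 - ((0 : M4) + x • e0) = a + (y - x) • e0 := by
      rw [sub_smul]; abel
    rw [e]
    calc c * Dkappa lam κ (a + (y - x) • e0)
        ≤ c * ((1 + |y - x| / lam) ^ κ * Dkappa lam κ a) := by
          gcongr; exact aux_D_shift lam κ hlam hκ a _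
      _ ≤ c * (((r⁻¹) ^ κ * (w (r * x) * w (r * y))) * Dkappa lam κ a) := by
          gcongr
          · exact hD0 a
          · exact aux_w lam κ hlam hκ r hr0 hr1 x y
      _ = _ := by rw [hK]; ring
  have step1 : ∀ x : ℝ, ‖adjoint (cj ((0 : M4) + x • e0) B) * cj a (Bn n)
      - cj a (Bn n) * adjoint (cj ((0 : M4) + x • e0) B)‖
      ≤ (K * (p * (r⁻¹ * G))) * w (r * x) := by
    intro x
    have e : ∀ τ, ‖f τ‖ * ((K * w (r * x)) * w (r * τ))
        = (K * w (r * x)) * (‖f τ‖ * w (r * τ)) := fun τ => by ring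
    refine (aux_comm_bound f (fun τ => cj (a + τ • e0) B) (cj a (Bn n)) _ (hint a) hTa
      (fun τ => (K * w (r * x)) * w (r * τ))
      (fun τ => mul_nonneg (mul_nonneg hK0 (hw0 _)) (hw0 _)) (hkey x) ?_).trans (le_of_eq ?_)
    · simp_rw [e]; exact hfwI.const_mul _
    · simp_rw [e]; rw [integral_const_mul, hfwint]; ring
  have hG0 : 0 ≤ G := integral_nonneg fun τ => mul_nonneg (norm_nonneg _) (hw0 τ)
  have step2 : ‖adjoint (cj a (Bn n)) * Bn n - Bn n * adjoint (cj a (Bn n))‖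
      ≤ (K * (p * (r⁻¹ * G))) * (p * (r⁻¹ * G)) := by
    have e : ∀ τ, ‖f τ‖ * ((K * (p * (r⁻¹ * G))) * w (r * τ))
        = (K * (p * (r⁻¹ * G))) * (‖f τ‖ * w (r * τ)) := fun τ => by ring
    refine (aux_comm_bound f (fun τ => cj ((0 : M4) + τ • e0) B) (Bn n) _ (hint 0) hT0
      (fun τ => (K * (p * (r⁻¹ * G))) * w (r * τ))
      (fun τ => mul_nonneg (by positivity) (hw0 _))
      (fun τ => (comm_swap _ _).symm.trans_le (step1 τ)) ?_).trans (le_of_eq ?_)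
    · simp_rw [e]; exact hfwI.const_mul _
    · simp_rw [e]; rw [integral_const_mul, hfwint]
  change ‖adjoint (Bn n) * cj a (Bn n) - cj a (Bn n) * adjoint (Bn n)‖ ≤ _
  rw [comm_swap]
  refine step2.trans (le_of_eq ?_)
  have hpow : (r⁻¹) ^ κ * (p * r⁻¹) * (p * r⁻¹) = (2 : ℝ) ^ (-((n : ℝ) * (2 * k - κ))) := by
    rw [hp, hr, ← Real.rpow_neg (by norm_num), neg_neg, ← Real.rpow_mul (by norm_num),
      ← Real.rpow_add (by norm_num), ← Real.rpow_add (by norm_num), ← Real.rpow_add (by norm_num)]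
    congr 1; ring
  rw [← hpow, hK]; ring
end
end
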